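/- There is a constant C > 0 such that for every integer ℓ ≥ 1, every polymer X, and every function f of class C¹ on a neighborhood of Q_ℓ(X): ∫_{∂X} |f|² dH¹ ≤ ∫_{∂Q_ℓ(X)} |f|² dH¹ + C·( ∫_Z |f|² + ‖∇f‖²_{B²_∞(Z)} ), where Z is the closure of Q_ℓ(X) \ X (itself a polymer, empty if Q_ℓ(X) = X). -/

import Mathlib

open MeasureTheory

noncomputable section

/-- The plane, with its Euclidean structure. -/
abbrev E2 := EuclideanSpace ℝ (Fin 2)

/-- The closed unit square (block) of the standard tessellation of `ℝ²` with lower-left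
corner `p ∈ ℤ²`. -/
def unitSquare (p : ℤ × ℤ) : Set E2 :=
  {x | (p.1 : ℝ) ≤ x 0 ∧ x 0 ≤ (p.1 : ℝ) + 1 ∧ (p.2 : ℝ) ≤ x 1 ∧ x 1 ≤ (p.2 : ℝ) + 1}

/-- The polymer (finite union of closed unit squares) indexed by a finite set `S ⊆ ℤ²`. -/
def polymerOf (S : Finset (ℤ × ℤ)) : Set E2 := ⋃ p ∈ S, unitSquare p

/-- The closed side-`ℓ` square of the coarse tessellation indexed by `q ∈ ℤ²`. -/
def bigSquare (ℓ : ℤ) (q : ℤ × ℤ) : Set E2 :=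
  {x | ((ℓ * q.1 : ℤ) : ℝ) ≤ x 0 ∧ x 0 ≤ ((ℓ * (q.1 + 1) : ℤ) : ℝ) ∧
       ((ℓ * q.2 : ℤ) : ℝ) ≤ x 1 ∧ x 1 ≤ ((ℓ * (q.2 + 1) : ℤ) : ℝ)}

/-- `Q_ℓ(X)`: the union of all closed side-`ℓ` squares of the coarse tessellation
meeting `X`. -/
def Qset (ℓ : ℤ) (X : Set E2) : Set E2 :=
  ⋃ q ∈ {q : ℤ × ℤ | (bigSquare ℓ q ∩ X).Nonempty}, bigSquare ℓ q

/-- Closed coordinate box. -/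
def cbox (a b c d : ℝ) : Set E2 := {x | a ≤ x 0 ∧ x 0 ≤ b ∧ c ≤ x 1 ∧ x 1 ≤ d}

/-- Half-open unit square. -/
def hsq (p : ℤ × ℤ) : Set E2 :=
  {x | (p.1 : ℝ) ≤ x 0 ∧ x 0 < (p.1 : ℝ) + 1 ∧ (p.2 : ℝ) ≤ x 1 ∧ x 1 < (p.2 : ℝ) + 1}

/-- Open unit square. -/
def osq (p : ℤ × ℤ) : Set E2 :=
  {x | (p.1 : ℝ) < x 0 ∧ x 0 < (p.1 : ℝ) + 1 ∧ (p.2 : ℝ) < x 1 ∧ x 1 < (p.2 : ℝ) + 1}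

lemma cont0 : Continuous (fun x : E2 => x 0) := by fun_prop

lemma cont1 : Continuous (fun x : E2 => x 1) := by fun_prop

lemma e2norm_sq (x : E2) : ‖x‖ ^ 2 = x 0 ^ 2 + x 1 ^ 2 := by
  rw [EuclideanSpace.norm_sq_eq]; simp

lemma isClosed_cbox (a b c d : ℝ) : IsClosed (cbox a b c d) :=
  (isClosed_le continuous_const cont0).inter <| (isClosed_le cont0 continuous_const).inter <|
    (isClosed_le continuous_const cont1).inter (isClosed_le cont1 continuous_const)

lemma isCompact_cbox (a b c d : ℝ) : IsCompact (cbox a b c d) := by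
  refine Metric.isCompact_of_isClosed_isBounded (isClosed_cbox a b c d) ?_
  refine (Metric.isBounded_closedBall (x := (0 : E2)) (r := |a| + |b| + |c| + |d|)).subset ?_
  rintro x ⟨h1, h2, h3, h4⟩
  rw [mem_closedBall_zero_iff]
  have hp : 0 ≤ |a| + |b| + |c| + |d| := by positivity
  refine abs_le_of_sq_le_sq' ?_ hp |>.2
  rw [e2norm_sq]
  have e0 : |x 0| ≤ |a| + |b| := by
    rw [abs_le]
    constructor <;> linarith [neg_abs_le a, le_abs_self b, abs_nonneg a, abs_nonneg b]
  have e1 : |x 1| ≤ |c| + |d| := by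
    rw [abs_le]
    constructor <;> linarith [neg_abs_le c, le_abs_self d, abs_nonneg c, abs_nonneg d]
  rw [← sq_abs (x 0), ← sq_abs (x 1)]
  nlinarith [abs_nonneg (x 0), abs_nonneg (x 1), abs_nonneg a, abs_nonneg b, abs_nonneg c,
    abs_nonneg d]

lemma unitSquare_eq (p : ℤ × ℤ) :
    unitSquare p = cbox (p.1 : ℝ) ((p.1 : ℝ) + 1) (p.2 : ℝ) ((p.2 : ℝ) + 1) := rfl

lemma bigSquare_eq (ℓ : ℤ) (q : ℤ × ℤ) :
    bigSquare ℓ q = cbox ((ℓ * q.1 : ℤ) : ℝ) ((ℓ * (q.1 + 1) : ℤ) : ℝ) ((ℓ * q.2 : ℤ) : ℝ)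
      ((ℓ * (q.2 + 1) : ℤ) : ℝ) := rfl

lemma convex_unitSquare (p : ℤ × ℤ) : Convex ℝ (unitSquare p) := by
  rintro x ⟨h1, h2, h3, h4⟩ y ⟨g1, g2, g3, g4⟩ a b ha hb hab
  have hb' : b = 1 - a := by linarith
  subst hb'
  refine ⟨?_, ?_, ?_, ?_⟩ <;> simp <;> nlinarith

lemma isCompact_polymerOf (S : Finset (ℤ × ℤ)) : IsCompact (polymerOf S) :=
  S.isCompact_biUnion fun p _ => isCompact_cbox _ _ _ _

/-- A compact set is contained in a box. -/
lemma exists_bound {K : Set E2} (hK : IsCompact K) : ∃ R : ℤ, ∀ x ∈ K, |x 0| ≤ R ∧ |x 1| ≤ R := by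
  obtain ⟨r, hr⟩ := hK.isBounded.subset_closedBall 0
  refine ⟨⌈r⌉, fun x hx => ?_⟩
  have h := hr hx
  rw [mem_closedBall_zero_iff] at h
  have h2 := Int.le_ceil r
  have h0 := PiLp.norm_apply_le x 0
  have h1 := PiLp.norm_apply_le x 1
  rw [Real.norm_eq_abs] at h0 h1
  constructor <;> linarith

lemma isCompact_Qset {ℓ : ℤ} (hℓ : 1 ≤ ℓ) {K : Set E2} (hK : IsCompact K) :
    IsCompact (Qset ℓ K) := by
  obtain ⟨R, hR⟩ := exists_bound hK
  refine Set.Finite.isCompact_biUnion ?_ fun q _ => isCompact_cbox _ _ _ _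
  refine ((Finset.Icc (-(|R|+1)) (|R|+1) ×ˢ Finset.Icc (-(|R|+1)) (|R|+1)).finite_toSet).subset ?_
  rintro ⟨a, b⟩ ⟨x, ⟨h1, h2, h3, h4⟩, hx⟩
  obtain ⟨r0, r1⟩ := hR x hx
  rw [abs_le] at r0 r1
  simp only at h1 h2 h3 h4
  have k1 : ℓ * a ≤ R := by exact_mod_cast h1.trans r0.2
  have k2 : -R ≤ ℓ * (a + 1) := Int.cast_le (R := ℝ).1 (by simpa using r0.1.trans h2)
  have k3 : ℓ * b ≤ R := by exact_mod_cast h3.trans r1.2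
  have k4 : -R ≤ ℓ * (b + 1) := Int.cast_le (R := ℝ).1 (by simpa using r1.1.trans h4)
  have hR0 := le_abs_self R
  have aux : ∀ a : ℤ, ℓ * a ≤ R → -R ≤ ℓ * (a + 1) → -(|R|+1) ≤ a ∧ a ≤ |R|+1 := by
    intro a k1 k2
    constructor
    · by_contra hc
      push Not at hc
      nlinarith [abs_nonneg R]
    · by_contra hc
      push Not at hc
      nlinarith [abs_nonneg R]
  simp only [Finset.coe_product, Finset.coe_Icc, Set.mem_prod, Set.mem_Icc]
  exact ⟨aux a k1 k2, aux b k3 k4⟩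

lemma finite_squares {K : Set E2} (hK : IsCompact K) : {p : ℤ × ℤ | unitSquare p ⊆ K}.Finite := by
  obtain ⟨R, hR⟩ := exists_bound hK
  refine ((Finset.Icc (-R) R ×ˢ Finset.Icc (-R) R).finite_toSet).subset ?_
  rintro ⟨a, b⟩ h
  have := hR (!₂[(a : ℝ), (b : ℝ)]) (h (by simp [unitSquare]))
  simp only [abs_le] at this
  obtain ⟨⟨h1, h2⟩, h3, h4⟩ := this
  simp at h1 h2 h3 h4
  simp only [Finset.coe_product, Finset.coe_Icc, Set.mem_prod, Set.mem_Icc]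
  refine ⟨⟨?_, ?_⟩, ?_, ?_⟩
  · exact_mod_cast h1
  · exact_mod_cast h2
  · exact_mod_cast h3
  · exact_mod_cast h4

lemma unitSquare_subset_bigSquare {ℓ : ℤ} (hℓ : 1 ≤ ℓ) (p : ℤ × ℤ) :
    unitSquare p ⊆ bigSquare ℓ (p.1 / ℓ, p.2 / ℓ) := by
  have aux : ∀ a : ℤ, ((ℓ * (a / ℓ) : ℤ) : ℝ) ≤ a ∧ (a : ℝ) + 1 ≤ ((ℓ * (a / ℓ + 1) : ℤ) : ℝ) := by
    intro a
    have h1 := Int.mul_ediv_add_emod a ℓ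
    have h2 := Int.emod_nonneg a (show ℓ ≠ 0 by omega)
    have h3 := Int.emod_lt_of_pos a (show 0 < ℓ by omega)
    constructor
    · exact_mod_cast (by linarith : ℓ * (a / ℓ) ≤ a)
    · exact_mod_cast (by linarith : a + 1 ≤ ℓ * (a / ℓ + 1))
  rintro x ⟨h1, h2, h3, h4⟩
  exact ⟨(aux p.1).1.trans h1, h2.trans (aux p.1).2, (aux p.2).1.trans h3, h4.trans (aux p.2).2⟩

lemma unitSquare_subset_closure (p : ℤ × ℤ) : unitSquare p ⊆ closure (osq p) := by
  rintro x ⟨h1, h2, h3, h4⟩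
  let c : E2 := !₂[(p.1 : ℝ) + 1/2, (p.2 : ℝ) + 1/2]
  have ht : Filter.Tendsto (fun t : ℝ => x + t • (c - x)) (nhdsWithin 0 (Set.Ioi 0)) (nhds x) := by
    have : Continuous (fun t : ℝ => x + t • (c - x)) := by fun_prop
    have h := this.tendsto 0
    simp only [zero_smul, add_zero] at h
    exact h.mono_left nhdsWithin_le_nhds
  refine mem_closure_of_tendsto ht ?_
  have : Set.Ioo (0 : ℝ) 1 ∈ nhdsWithin (0 : ℝ) (Set.Ioi 0) := Ioo_mem_nhdsGT one_pos
  filter_upwards [this] with t ht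
  obtain ⟨t0, t1⟩ := ht
  refine ⟨?_, ?_, ?_, ?_⟩ <;> simp [c] <;> nlinarith

lemma osq_inter {p q : ℤ × ℤ} {x : E2} (hx : x ∈ osq p) (hq : x ∈ unitSquare q) : q = p := by
  obtain ⟨h1, h2, h3, h4⟩ := hx
  obtain ⟨g1, g2, g3, g4⟩ := hq
  have a1 : q.1 < p.1 + 1 := by exact_mod_cast g1.trans_lt h2
  have a2 : p.1 < q.1 + 1 := by exact_mod_cast h1.trans_le g2
  have a3 : q.2 < p.2 + 1 := by exact_mod_cast g3.trans_lt h4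
  have a4 : p.2 < q.2 + 1 := by exact_mod_cast h3.trans_le g4
  ext <;> omega

lemma exists_square_of_frontier {S : Finset (ℤ × ℤ)} {x : E2} (hx : x ∈ frontier (polymerOf S)) :
    ∃ p, p ∉ S ∧ x ∈ unitSquare p := by
  classical
  rw [frontier_eq_closure_inter_closure] at hx
  have h2 := hx.2
  let G : Finset (ℤ × ℤ) := (Finset.Icc (⌊x 0⌋ - 3) (⌊x 0⌋ + 3) ×ˢ
    Finset.Icc (⌊x 1⌋ - 3) (⌊x 1⌋ + 3)).filter (· ∉ S)
  let V : Set E2 := {y | x 0 - 1 < y 0 ∧ y 0 < x 0 + 1 ∧ x 1 - 1 < y 1 ∧ y 1 < x 1 + 1}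
  have hV : IsOpen V :=
    (isOpen_lt continuous_const cont0).inter <| (isOpen_lt cont0 continuous_const).inter <|
    (isOpen_lt continuous_const cont1).inter (isOpen_lt cont1 continuous_const)
  have hxV : x ∈ V := by refine ⟨?_, ?_, ?_, ?_⟩ <;> linarith
  have hsub : V ∩ (polymerOf S)ᶜ ⊆ ⋃ p ∈ G, unitSquare p := by
    rintro y ⟨⟨v1, v2, v3, v4⟩, hy⟩
    have hyp : y ∈ unitSquare (⌊y 0⌋, ⌊y 1⌋) :=
      ⟨Int.floor_le _, (Int.lt_floor_add_one _).le, Int.floor_le _, (Int.lt_floor_add_one _).le⟩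
    refine Set.mem_biUnion (x := (⌊y 0⌋, ⌊y 1⌋)) ?_ hyp
    have hnS : (⌊y 0⌋, ⌊y 1⌋) ∉ S := fun h => hy (Set.mem_biUnion h hyp)
    have aux : ∀ s t : ℝ, s - 1 < t → t < s + 1 → ⌊s⌋ - 3 ≤ ⌊t⌋ ∧ ⌊t⌋ ≤ ⌊s⌋ + 3 := by
      intro s t k1 k2
      have a1 := Int.floor_le s
      have a2 := Int.lt_floor_add_one s
      have a3 := Int.floor_le t
      have a4 := Int.lt_floor_add_one t
      constructor
      · have : (⌊s⌋ : ℝ) - 3 ≤ ⌊t⌋ := by linarith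
        exact_mod_cast this
      · have : (⌊t⌋ : ℝ) ≤ ⌊s⌋ + 3 := by linarith
        exact_mod_cast this
    simp only [G, Finset.coe_filter, Finset.mem_product, Finset.mem_Icc, Set.mem_setOf_eq]
    exact ⟨⟨aux _ _ v1 v2, aux _ _ v3 v4⟩, hnS⟩
  have hcl : IsClosed (⋃ p ∈ G, unitSquare p) :=
    (G.isCompact_biUnion fun p _ => isCompact_cbox _ _ _ _).isClosed
  have hmem : x ∈ closure (V ∩ (polymerOf S)ᶜ) := hV.inter_closure ⟨hxV, h2⟩
  have := closure_minimal hsub hcl hmem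
  simp only [Set.mem_iUnion] at this
  obtain ⟨p, hp, hxp⟩ := this
  exact ⟨p, (Finset.mem_filter.1 hp).2, hxp⟩

/-- The frontier is covered by the boundaries of blocks of `Z`. -/
lemma frontier_cover {ℓ : ℤ} (hℓ : 1 ≤ ℓ) {S : Finset (ℤ × ℤ)} {x : E2}
    (hx : x ∈ frontier (polymerOf S)) :
    ∃ p, unitSquare p ⊆ closure (Qset ℓ (polymerOf S) \ polymerOf S) ∧
      x ∈ unitSquare p \ osq p := by
  obtain ⟨p, hpS, hxp⟩ := exists_square_of_frontier hx
  have hxX : x ∈ polymerOf S := by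
    have := frontier_subset_closure hx
    rwa [(isCompact_polymerOf S).isClosed.closure_eq] at this
  have hdis : ∀ y ∈ osq p, y ∉ polymerOf S := by
    intro y hy hyS
    simp only [polymerOf, Set.mem_iUnion] at hyS
    obtain ⟨q, hq, hyq⟩ := hyS
    exact hpS (osq_inter hy hyq ▸ hq)
  refine ⟨p, (unitSquare_subset_closure p).trans (closure_mono ?_), hxp, fun h => hdis x h hxX⟩
  intro y hy
  refine ⟨?_, hdis y hy⟩
  have hyp : y ∈ unitSquare p := ⟨hy.1.le, hy.2.1.le, hy.2.2.1.le, hy.2.2.2.le⟩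
  exact Set.mem_biUnion (x := (p.1 / ℓ, p.2 / ℓ))
    (show (bigSquare ℓ (p.1 / ℓ, p.2 / ℓ) ∩ polymerOf S).Nonempty from
      ⟨x, unitSquare_subset_bigSquare hℓ p hxp, hxX⟩) (unitSquare_subset_bigSquare hℓ p hyp)

lemma isClosed_edge (p : ℤ × ℤ) : IsClosed (unitSquare p \ osq p) := by
  refine (isClosed_cbox _ _ _ _).sdiff ?_
  exact (isOpen_lt continuous_const cont0).inter <| (isOpen_lt cont0 continuous_const).inter <|
    (isOpen_lt continuous_const cont1).inter (isOpen_lt cont1 continuous_const)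

lemma seg_v (a c : ℝ) :
    (μH[1] : Measure E2) ((fun t : ℝ => (!₂[a, c + t] : E2)) '' Set.Icc 0 1) ≤ 1 := by
  have hL : LipschitzOnWith 1 (fun t : ℝ => (!₂[a, c + t] : E2)) (Set.Icc 0 1) := by
    refine LipschitzWith.lipschitzOnWith (LipschitzWith.of_dist_le_mul fun s t => ?_)
    rw [EuclideanSpace.dist_eq]
    simp [Real.dist_eq, Real.sqrt_sq_eq_abs]
  refine (hL.hausdorffMeasure_image_le zero_le_one).trans ?_
  rw [hausdorffMeasure_real]
  simp

lemma seg_h (a c : ℝ) :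
    (μH[1] : Measure E2) ((fun t : ℝ => (!₂[a + t, c] : E2)) '' Set.Icc 0 1) ≤ 1 := by
  have hL : LipschitzOnWith 1 (fun t : ℝ => (!₂[a + t, c] : E2)) (Set.Icc 0 1) := by
    refine LipschitzWith.lipschitzOnWith (LipschitzWith.of_dist_le_mul fun s t => ?_)
    rw [EuclideanSpace.dist_eq]
    simp [Real.dist_eq, Real.sqrt_sq_eq_abs]
  refine (hL.hausdorffMeasure_image_le zero_le_one).trans ?_
  rw [hausdorffMeasure_real]
  simp

lemma edge_measure (p : ℤ × ℤ) : (μH[1] : Measure E2) (unitSquare p \ osq p) ≤ 4 := by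
  have hsub : unitSquare p \ osq p ⊆
      (((fun t : ℝ => (!₂[(p.1 : ℝ), (p.2 : ℝ) + t] : E2)) '' Set.Icc 0 1) ∪
        ((fun t : ℝ => (!₂[(p.1 : ℝ) + 1, (p.2 : ℝ) + t] : E2)) '' Set.Icc 0 1)) ∪
      (((fun t : ℝ => (!₂[(p.1 : ℝ) + t, (p.2 : ℝ)] : E2)) '' Set.Icc 0 1) ∪
        ((fun t : ℝ => (!₂[(p.1 : ℝ) + t, (p.2 : ℝ) + 1] : E2)) '' Set.Icc 0 1)) := by
    rintro x ⟨⟨h1, h2, h3, h4⟩, hn⟩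
    by_cases e1 : x 0 = p.1
    · refine Or.inl (Or.inl ⟨x 1 - p.2, ⟨by linarith, by linarith⟩, ?_⟩)
      ext i; fin_cases i <;> simp [e1]
    by_cases e2 : x 0 = p.1 + 1
    · refine Or.inl (Or.inr ⟨x 1 - p.2, ⟨by linarith, by linarith⟩, ?_⟩)
      ext i; fin_cases i <;> simp [e2]
    by_cases e3 : x 1 = p.2
    · refine Or.inr (Or.inl ⟨x 0 - p.1, ⟨by linarith, by linarith⟩, ?_⟩)
      ext i; fin_cases i <;> simp [e3]
    by_cases e4 : x 1 = p.2 + 1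
    · refine Or.inr (Or.inr ⟨x 0 - p.1, ⟨by linarith, by linarith⟩, ?_⟩)
      ext i; fin_cases i <;> simp [e4]
    exact absurd ⟨lt_of_le_of_ne h1 (Ne.symm e1), lt_of_le_of_ne h2 e2,
      lt_of_le_of_ne h3 (Ne.symm e3), lt_of_le_of_ne h4 e4⟩ hn
  refine (measure_mono hsub).trans ((measure_union_le _ _).trans ?_)
  calc _ ≤ (1 + 1 : ENNReal) + (1 + 1) := by
        refine add_le_add ((measure_union_le _ _).trans ?_) ((measure_union_le _ _).trans ?_)
        · exact add_le_add (seg_v _ _) (seg_v _ _)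
        · exact add_le_add (seg_h _ _) (seg_h _ _)
    _ = 4 := by norm_num

lemma volume_hsq (p : ℤ × ℤ) : volume (hsq p) = 1 := by
  have h : hsq p = (MeasurableEquiv.toLp 2 (Fin 2 → ℝ)).symm ⁻¹'
      (Set.pi Set.univ fun i : Fin 2 =>
        Set.Ico ((![(p.1 : ℝ), (p.2 : ℝ)]) i) ((![(p.1 : ℝ) + 1, (p.2 : ℝ) + 1]) i)) := by
    ext x
    simp [hsq, Set.mem_pi, Fin.forall_fin_two, and_assoc]
  rw [h, (EuclideanSpace.volume_preserving_symm_measurableEquiv_toLp (Fin 2)).measure_preimage_equiv,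
    Real.volume_pi_Ico]
  simp

lemma measurableSet_hsq (p : ℤ × ℤ) : MeasurableSet (hsq p) :=
  (measurableSet_le measurable_const cont0.measurable).inter <|
    (measurableSet_lt cont0.measurable measurable_const).inter <|
    (measurableSet_le measurable_const cont1.measurable).inter
      (measurableSet_lt cont1.measurable measurable_const)

lemma hsq_subset (p : ℤ × ℤ) : hsq p ⊆ unitSquare p :=
  fun _ h => ⟨h.1, h.2.1.le, h.2.2.1, h.2.2.2.le⟩

lemma hsq_inj {p q : ℤ × ℤ} {x : E2} (hx : x ∈ hsq p) (hq : x ∈ hsq q) : p = q := by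
  obtain ⟨h1, h2, h3, h4⟩ := hx
  obtain ⟨g1, g2, g3, g4⟩ := hq
  have a1 : q.1 < p.1 + 1 := by exact_mod_cast g1.trans_lt h2
  have a2 : p.1 < q.1 + 1 := by exact_mod_cast h1.trans_lt g2
  have a3 : q.2 < p.2 + 1 := by exact_mod_cast g3.trans_lt h4
  have a4 : p.2 < q.2 + 1 := by exact_mod_cast h3.trans_lt g4
  ext <;> omega

/-- `sup_B |∇f|²`. -/
abbrev gsup (f : E2 → ℝ) (p : ℤ × ℤ) : ℝ := ⨆ x ∈ unitSquare p, ‖fderiv ℝ f x‖ ^ 2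

lemma le_gsup {f : E2 → ℝ} {U : Set E2} (hU : IsOpen U) (hf : ContDiffOn ℝ 1 f U)
    {p : ℤ × ℤ} (hp : unitSquare p ⊆ U) {x : E2} (hx : x ∈ unitSquare p) :
    ‖fderiv ℝ f x‖ ^ 2 ≤ gsup f p := by
  have hc : ContinuousOn (fun x => ‖fderiv ℝ f x‖ ^ 2) (unitSquare p) :=
    (((hf.continuousOn_fderiv_of_isOpen hU le_rfl).mono hp).norm).pow 2
  obtain ⟨M, hM⟩ := (isCompact_cbox _ _ _ _).bddAbove_image hc
  have hM' : ∀ y ∈ unitSquare p, ‖fderiv ℝ f y‖ ^ 2 ≤ M := fun y hy => hM ⟨y, hy, rfl⟩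
  have hbdd : BddAbove (Set.range fun x => ⨆ (_ : x ∈ unitSquare p), ‖fderiv ℝ f x‖ ^ 2) := by
    refine ⟨max M 0, ?_⟩
    rintro _ ⟨y, rfl⟩
    by_cases hy : y ∈ unitSquare p
    · simp only [hy, ciSup_unique]
      exact (hM' y hy).trans (le_max_left _ _)
    · simp [hy]
  refine le_trans ?_ (le_ciSup hbdd x)
  simp [hx]

lemma pointwise_bound {f : E2 → ℝ} {U : Set E2} (hU : IsOpen U) (hf : ContDiffOn ℝ 1 f U)
    {p : ℤ × ℤ} (hp : unitSquare p ⊆ U) {x y : E2} (hx : x ∈ unitSquare p)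
    (hy : y ∈ unitSquare p) : f x ^ 2 ≤ 2 * f y ^ 2 + 4 * gsup f p := by
  have hM0 : 0 ≤ gsup f p := (sq_nonneg _).trans (le_gsup hU hf hp hx)
  have hb : ∀ z ∈ unitSquare p, ‖fderiv ℝ f z‖ ≤ √(gsup f p) := fun z hz =>
    Real.le_sqrt_of_sq_le (le_gsup hU hf hp hz)
  have h := (convex_unitSquare p).norm_image_sub_le_of_norm_fderiv_le (𝕜 := ℝ)
    (fun z hz => (hf.differentiableOn one_ne_zero).differentiableAt (hU.mem_nhds (hp hz))) hb hy hx
  have hd : ‖x - y‖ ^ 2 ≤ 2 := by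
    rw [e2norm_sq]
    obtain ⟨h1, h2, h3, h4⟩ := hx
    obtain ⟨g1, g2, g3, g4⟩ := hy
    simp only [PiLp.sub_apply]
    nlinarith
  have h2 : (f x - f y) ^ 2 ≤ gsup f p * 2 := by
    have := pow_le_pow_left₀ (norm_nonneg _) h 2
    rw [mul_pow, Real.sq_sqrt hM0, Real.norm_eq_abs, sq_abs] at this
    nlinarith
  nlinarith [sq_nonneg (f x - 2 * f y)]

lemma sup_bound {f : E2 → ℝ} {U : Set E2} (hU : IsOpen U) (hf : ContDiffOn ℝ 1 f U)
    {p : ℤ × ℤ} (hp : unitSquare p ⊆ U) {x : E2} (hx : x ∈ unitSquare p) :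
    f x ^ 2 ≤ 2 * (∫ y in hsq p, f y ^ 2) + 4 * gsup f p := by
  have hint : IntegrableOn (fun y => f y ^ 2) (hsq p) := by
    refine IntegrableOn.mono_set (t := unitSquare p) ?_ (hsq_subset p)
    exact ((hf.continuousOn.mono hp).pow 2).integrableOn_compact (isCompact_cbox _ _ _ _)
  have hfin : volume (hsq p) ≠ ⊤ := by rw [volume_hsq]; simp
  have hc1 : IntegrableOn (fun _ : E2 => f x ^ 2) (hsq p) := integrableOn_const hfin
  have hc2 : IntegrableOn (fun _ : E2 => 4 * gsup f p) (hsq p) := integrableOn_const hfin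
  have h := setIntegral_mono_on hc1 ((hint.const_mul 2).add hc2) (measurableSet_hsq p)
    (fun y hy => pointwise_bound hU hf hp hx (hsq_subset p hy))
  have hr : volume.real (hsq p) = 1 := by simp [Measure.real, volume_hsq]
  simp only [Pi.add_apply] at h
  rw [integral_add (hint.const_mul 2) hc2, integral_const_mul, setIntegral_const,
    setIntegral_const, hr] at h
  simpa using h

/-- There is `C > 0` such that for every `ℓ ≥ 1`, every polymer `X` and every `f` of
class `C¹` on a neighborhood of `Q_ℓ(X)`:
`∫_{∂X} |f|² dH¹ ≤ ∫_{∂Q_ℓ(X)} |f|² dH¹ + C (∫_Z |f|² + ‖∇f‖²_{B²_∞(Z)})`,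
where `Z` is the closure of `Q_ℓ(X) \ X`. -/
theorem stmt7 :
    ∃ C : ℝ, 0 < C ∧
      ∀ ℓ : ℤ, 1 ≤ ℓ →
        ∀ S : Finset (ℤ × ℤ), S.Nonempty →
          ∀ (f : E2 → ℝ) (U : Set E2), IsOpen U → Qset ℓ (polymerOf S) ⊆ U →
            ContDiffOn ℝ 1 f U →
            (∫ x in frontier (polymerOf S), f x ^ 2 ∂(μH[1])) ≤
              (∫ x in frontier (Qset ℓ (polymerOf S)), f x ^ 2 ∂(μH[1])) +
              C * ((∫ x in closure (Qset ℓ (polymerOf S) \ polymerOf S), f x ^ 2) +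
                ∑' p : {p : ℤ × ℤ //
                    unitSquare p ⊆ closure (Qset ℓ (polymerOf S) \ polymerOf S)},
                  ⨆ x ∈ unitSquare p.1, ‖fderiv ℝ f x‖ ^ 2) := by
  refine ⟨16, by norm_num, ?_⟩
  intro ℓ hℓ S _ f U hU hQU hf
  set Z := closure (Qset ℓ (polymerOf S) \ polymerOf S) with hZdef
  have hQc : IsCompact (Qset ℓ (polymerOf S)) := isCompact_Qset hℓ (isCompact_polymerOf S)
  have hZQ : Z ⊆ Qset ℓ (polymerOf S) := closure_minimal Set.diff_subset hQc.isClosed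
  have hZc : IsCompact Z := hQc.of_isClosed_subset isClosed_closure hZQ
  have hZU : Z ⊆ U := hZQ.trans hQU
  haveI : Finite {p : ℤ × ℤ // unitSquare p ⊆ Z} := (finite_squares hZc).to_subtype
  haveI := Fintype.ofFinite {p : ℤ × ℤ // unitSquare p ⊆ Z}
  rw [tsum_fintype]
  have hbnd : ∀ i : {p : ℤ × ℤ // unitSquare p ⊆ Z}, ∀ x ∈ unitSquare i.1 \ osq i.1,
      ‖f x ^ 2‖ ≤ 2 * (∫ y in hsq i.1, f y ^ 2) + 4 * gsup f i.1 := by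
    intro i x hx
    rw [Real.norm_of_nonneg (sq_nonneg _)]
    exact sup_bound hU hf (i.2.trans hZU) hx.1
  have hfin : ∀ i : {p : ℤ × ℤ // unitSquare p ⊆ Z},
      (μH[1] : Measure E2) (unitSquare i.1 \ osq i.1) < ⊤ := fun i =>
    (edge_measure i.1).trans_lt (by simp)
  have hmeas : ∀ i : {p : ℤ × ℤ // unitSquare p ⊆ Z}, MeasurableSet (unitSquare i.1 \ osq i.1) :=
    fun i => (isClosed_edge i.1).measurableSet
  have hint : ∀ i : {p : ℤ × ℤ // unitSquare p ⊆ Z},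
      Integrable (fun x => f x ^ 2) ((μH[1] : Measure E2).restrict (unitSquare i.1 \ osq i.1)) := by
    intro i
    refine ⟨?_, HasFiniteIntegral.restrict_of_bounded
      (C := 2 * (∫ y in hsq i.1, f y ^ 2) + 4 * gsup f i.1) (hfin i) ?_⟩
    · have hcont : ContinuousOn (fun x => f x ^ 2) (unitSquare i.1 \ osq i.1) :=
        (hf.continuousOn.mono (Set.diff_subset.trans (i.2.trans hZU))).pow 2
      exact hcont.aestronglyMeasurable (hmeas i)
    · exact (ae_restrict_iff' (hmeas i)).2 (Filter.Eventually.of_forall (hbnd i))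
  have hle : (μH[1] : Measure E2).restrict (frontier (polymerOf S)) ≤
      ∑ i : {p : ℤ × ℤ // unitSquare p ⊆ Z},
        (μH[1] : Measure E2).restrict (unitSquare i.1 \ osq i.1) := by
    have hsub : frontier (polymerOf S) ⊆
        ⋃ i : {p : ℤ × ℤ // unitSquare p ⊆ Z}, unitSquare i.1 \ osq i.1 := by
      intro x hx
      obtain ⟨p, hp, hxp⟩ := frontier_cover hℓ hx
      exact Set.mem_iUnion.2 ⟨⟨p, hp⟩, hxp⟩
    refine (Measure.restrict_mono hsub le_rfl).trans ?_
    rw [← Measure.sum_fintype]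
    exact Measure.restrict_iUnion_le
  have h1 : (∫ x in frontier (polymerOf S), f x ^ 2 ∂(μH[1])) ≤
      ∑ i : {p : ℤ × ℤ // unitSquare p ⊆ Z},
        ∫ x in unitSquare i.1 \ osq i.1, f x ^ 2 ∂(μH[1]) := by
    rw [← integral_finset_sum_measure (fun i _ => hint i)]
    refine integral_mono_measure hle (Filter.Eventually.of_forall fun x => sq_nonneg _) ?_
    exact integrable_finset_sum_measure.2 fun i _ => hint i
  have h2 : ∀ i : {p : ℤ × ℤ // unitSquare p ⊆ Z},
      (∫ x in unitSquare i.1 \ osq i.1, f x ^ 2 ∂(μH[1])) ≤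
        8 * (∫ y in hsq i.1, f y ^ 2) + 16 * gsup f i.1 := by
    intro i
    have hK : 0 ≤ 2 * (∫ y in hsq i.1, f y ^ 2) + 4 * gsup f i.1 := by
      have : (!₂[(i.1.1 : ℝ), (i.1.2 : ℝ)] : E2) ∈ unitSquare i.1 := by simp [unitSquare]
      exact (sq_nonneg _).trans (sup_bound hU hf (i.2.trans hZU) this)
    have h := (le_abs_self _).trans (norm_setIntegral_le_of_norm_le_const (hfin i) (hbnd i))
    have h4 : (μH[1] : Measure E2).real (unitSquare i.1 \ osq i.1) ≤ 4 :=
      ENNReal.toReal_le_of_le_ofReal (by norm_num) (by simpa using edge_measure i.1)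
    nlinarith [mul_le_mul_of_nonneg_left h4 hK]
  have hZint : IntegrableOn (fun x => f x ^ 2) Z :=
    ((hf.continuousOn.mono hZU).pow 2).integrableOn_compact hZc
  have hH : ∀ i : {p : ℤ × ℤ // unitSquare p ⊆ Z}, hsq i.1 ⊆ Z := fun i =>
    (hsq_subset i.1).trans i.2
  have h3 : ∑ i : {p : ℤ × ℤ // unitSquare p ⊆ Z}, (∫ y in hsq i.1, f y ^ 2) ≤
      ∫ y in Z, f y ^ 2 := by
    rw [← integral_iUnion_fintype (fun i => measurableSet_hsq i.1) ?_
      (fun i => hZint.mono_set (hH i))]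
    · exact setIntegral_mono_set hZint (Filter.Eventually.of_forall fun x => sq_nonneg _)
        (Set.iUnion_subset hH).eventuallyLE
    · intro i j hij
      exact Set.disjoint_left.2 fun x hx hx' => hij (Subtype.ext (hsq_inj hx hx'))
  have h4 : 0 ≤ ∫ x in frontier (Qset ℓ (polymerOf S)), f x ^ 2 ∂(μH[1]) :=
    integral_nonneg fun x => sq_nonneg _
  have h5 : 0 ≤ ∫ y in Z, f y ^ 2 := integral_nonneg fun x => sq_nonneg _
  have h6 := h1.trans (Finset.sum_le_sum fun i _ => h2 i)
  rw [Finset.sum_add_distrib, ← Finset.mul_sum, ← Finset.mul_sum] at h6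
  simp only [gsup] at h6
  linarith

end
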